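/- arXiv:1409.6136 — 2 statements merged into one kernel-verified Lean document; each statement's English description precedes it below -/
import Mathlib

section
/- Let l ≥ 2 and let g = ((A, B),(C, D)) ∈ U(2l,K) be written in l×l block form. Suppose A = diag(1,1,…,1,λ) with λ ≠ 0. Then C has the block form ((C₁₁, −λ·ᵀC̄₂₁),(C₂₁, c)), where C₁₁ is an (l−1)×(l−1) skew-Hermitian matrix, C₂₁ is a row of length l−1, and the scalar c satisfies λ̄·c ∈ K°. -/
open Matrix

/-- **Corollary to Lemma A, part 1.** If `g = ((A,B),(C,D)) ∈ U(2l,K)` with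
`A = diag(1,…,1,λ)`, `λ ≠ 0`, then `C = ((C₁₁, −λ ᵀC̄₂₁),(C₂₁, c))` with `C₁₁`
skew-Hermitian of size `l-1` and `λ̄ c ∈ K°`. Here `l = m + 1` and the rows/columns of
the `l × l` blocks are indexed by `Fin m ⊕ Unit`. -/
theorem lower_left_block_of_unitary_diag_upper_left
    (m : ℕ) (hm : 1 ≤ m)
    {K : Type*} [Field K] (σ : K ≃+* K) (hσ2 : ∀ x, σ (σ x) = x) (hσne : ⇑σ ≠ id)
    (lam : K) (hlam : lam ≠ 0)
    (A B C D : Matrix (Fin m ⊕ Unit) (Fin m ⊕ Unit) K)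
    (hA : A = fromBlocks 1 0 0 (lam • 1))
    (hg : (((fromBlocks A B C D).map σ)ᵀ) *
            fromBlocks (0 : Matrix (Fin m ⊕ Unit) (Fin m ⊕ Unit) K) 1 1 0 *
            fromBlocks A B C D
          = fromBlocks 0 1 1 0) :
    ∃ (C₁₁ : Matrix (Fin m) (Fin m) K) (C₂₁ : Matrix Unit (Fin m) K) (c : K),
      C = fromBlocks C₁₁ (-(lam • (C₂₁.map σ)ᵀ)) C₂₁ (c • 1) ∧
      ((C₁₁.map σ)ᵀ = -C₁₁) ∧
      σ (σ lam * c) = -(σ lam * c) := by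
  have hblock : (C.map σ)ᵀ * A + (A.map σ)ᵀ * C = 0 := by
    rw [fromBlocks_map, fromBlocks_transpose, fromBlocks_multiply, fromBlocks_multiply] at hg
    simpa using (fromBlocks_inj.mp hg).1
  obtain ⟨C₁₁, C₁₂, C₂₁, C₂₂, rfl⟩ :
      ∃ C₁₁ C₁₂ C₂₁ C₂₂, C = fromBlocks C₁₁ C₁₂ C₂₁ C₂₂ :=
    ⟨_, _, _, _, (fromBlocks_toBlocks C).symm⟩
  have hsmul : (lam • (1 : Matrix Unit Unit K)).map σ = σ lam • 1 := by
    ext i j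
    simp
  rw [hA, fromBlocks_map, fromBlocks_map, fromBlocks_transpose, fromBlocks_transpose,
    fromBlocks_multiply, fromBlocks_multiply, fromBlocks_add, ← fromBlocks_zero,
    fromBlocks_inj, hsmul] at hblock
  obtain ⟨h₁₁, h₁₂, -, h₂₂⟩ := hblock
  replace h₁₁ : (C₁₁.map σ)ᵀ + C₁₁ = 0 := by simpa using h₁₁
  replace h₁₂ : lam • (C₂₁.map σ)ᵀ + C₁₂ = 0 := by simpa using h₁₂
  replace h₂₂ : lam • (C₂₂.map σ)ᵀ + σ lam • C₂₂ = 0 := by simpa using h₂₂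
  refine ⟨C₁₁, C₂₁, C₂₂ () (), ?_, eq_neg_of_add_eq_zero_left h₁₁, ?_⟩
  · have hc : C₂₂ () () • (1 : Matrix Unit Unit K) = C₂₂ := by
      ext i j
      simp
    rw [← eq_neg_of_add_eq_zero_right h₁₂, hc]
  · have h : lam * σ (C₂₂ () ()) + σ lam * C₂₂ () () = 0 := congrFun (congrFun h₂₂ ()) ()
    rw [map_mul, hσ2]
    exact eq_neg_of_add_eq_zero_left h
end

section
/- Let l ≥ 2 and let g = ((A, B),(C, D)) ∈ U(2l,K) be written in l×l block form. Suppose A = diag(1,…,1,0,…,0) with the number of 1s equal to m, where 0 < m < l. Then C has the block form ((C₁₁, 0),(C₂₁, C₂₂)) with C₁₁ of size m×m, where C₁₁ is skew-Hermitian. -/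
open Matrix

/-- **Corollary to Lemma A, part 2.** If `g = ((A,B),(C,D)) ∈ U(2l,K)` with
`A = diag(1,…,1,0,…,0)` (number of `1`s equal to `m`, `0 < m < l`), then
`C = ((C₁₁, 0),(C₂₁, C₂₂))` with `C₁₁` an `m × m` skew-Hermitian matrix. Here
`l = m + k` and the rows/columns of the `l × l` blocks are indexed by `Fin m ⊕ Fin k`. -/
theorem lower_left_block_of_unitary_singular_upper_left
    (m k : ℕ) (hm : 0 < m) (hk : 0 < k)
    {K : Type*} [Field K] (σ : K ≃+* K) (hσ2 : ∀ x, σ (σ x) = x) (hσne : ⇑σ ≠ id)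
    (A B C D : Matrix (Fin m ⊕ Fin k) (Fin m ⊕ Fin k) K)
    (hA : A = fromBlocks 1 0 0 0)
    (hg : (((fromBlocks A B C D).map σ)ᵀ) *
            fromBlocks (0 : Matrix (Fin m ⊕ Fin k) (Fin m ⊕ Fin k) K) 1 1 0 *
            fromBlocks A B C D
          = fromBlocks 0 1 1 0) :
    ∃ (C₁₁ : Matrix (Fin m) (Fin m) K) (C₂₁ : Matrix (Fin k) (Fin m) K)
      (C₂₂ : Matrix (Fin k) (Fin k) K),
      C = fromBlocks C₁₁ 0 C₂₁ C₂₂ ∧ ((C₁₁.map σ)ᵀ = -C₁₁) := by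
  subst hA
  rw [← fromBlocks_toBlocks C] at hg ⊢
  simp only [fromBlocks_map, fromBlocks_transpose, fromBlocks_multiply, fromBlocks_inj] at hg
  obtain ⟨h, -⟩ := hg
  simp only [Matrix.mul_zero, Matrix.mul_one, zero_add, add_zero, fromBlocks_multiply,
    map_zero, map_one, Matrix.map_zero, Matrix.map_one, transpose_zero, transpose_one,
    Matrix.zero_mul, Matrix.one_mul, fromBlocks_add, ← fromBlocks_zero, fromBlocks_inj] at h
  obtain ⟨h₁₁, h₁₂, -⟩ := h
  exact ⟨C.toBlocks₁₁, C.toBlocks₂₁, C.toBlocks₂₂, by rw [h₁₂], eq_neg_of_add_eq_zero_left h₁₁⟩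
end
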